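/- A metric space X has Lipschitz dimension 0 (i.e., there exists C > 0 such that for every r > 0 every r-path in X has diameter at most C·r) if and only if X has Nagata dimension 0 (i.e., there exists c > 0 such that for every s > 0 there is a cover of X by sets each of diameter at most c·s with s-multiplicity at most 1). -/

import Mathlib

open Metric Set

/-- `f` is Lipschitz light with constant `C`: `f` is `C`-Lipschitz, and for every `r > 0`
and every `W ⊆ Y` of diameter at most `r`, every `r`-path contained in `f ⁻¹' W`
has diameter at most `C * r`. -/
def LipschitzLightWith {X Y : Type*} [PseudoMetricSpace X] [PseudoMetricSpace Y]
    (C : ℝ) (f : X → Y) : Prop :=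
  (∀ x x', dist (f x) (f x') ≤ C * dist x x') ∧
  ∀ r > 0, ∀ W : Set Y, (∀ w ∈ W, ∀ w' ∈ W, dist w w' ≤ r) →
    ∀ (k : ℕ) (p : ℕ → X), (∀ i ≤ k, f (p i) ∈ W) →
      (∀ i < k, dist (p i) (p (i + 1)) ≤ r) →
      ∀ i ≤ k, ∀ j ≤ k, dist (p i) (p j) ≤ C * r

/-- `f` is Lipschitz light if it is Lipschitz light with some constant `C > 0`. -/
def LipschitzLight {X Y : Type*} [PseudoMetricSpace X] [PseudoMetricSpace Y]
    (f : X → Y) : Prop :=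
  ∃ C > 0, LipschitzLightWith C f
/-- A metric space `X` has Nagata dimension at most `n`: there is `c > 0` such that for
every `s > 0` there is a cover of `X` by sets of diameter at most `c * s` such that every
subset of `X` of diameter at most `s` meets at most `n + 1` members of the cover. -/
def NagataDimLE (X : Type*) [PseudoMetricSpace X] (n : ℕ) : Prop :=
  ∃ c > 0, ∀ s > 0, ∃ 𝒰 : Set (Set X),
    (∀ x : X, ∃ U ∈ 𝒰, x ∈ U) ∧
    (∀ U ∈ 𝒰, ∀ x ∈ U, ∀ y ∈ U, dist x y ≤ c * s) ∧
    (∀ E : Set X, (∀ x ∈ E, ∀ y ∈ E, dist x y ≤ s) →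
      {U : Set X | U ∈ 𝒰 ∧ (U ∩ E).Nonempty}.encard ≤ (n + 1 : ℕ∞))

theorem Relation.ReflTransGen.exists_nat_path {α : Type*} {R : α → α → Prop} {x y : α}
    (h : Relation.ReflTransGen R x y) :
    ∃ (k : ℕ) (p : ℕ → α), p 0 = x ∧ p k = y ∧ ∀ i < k, R (p i) (p (i + 1)) := by
  induction h using Relation.ReflTransGen.head_induction_on with
  | refl => exact ⟨0, fun _ => y, rfl, rfl, by simp⟩
  | @head a b hab _ ih =>
    obtain ⟨k, p, rfl, hk, hp⟩ := ih
    refine ⟨k + 1, fun i => Nat.casesOn i a p, rfl, hk, ?_⟩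
    rintro (_ | i) hi
    · exact hab
    · exact hp i (by omega)

/-- A metric space has Lipschitz dimension `0` if and only if it has Nagata dimension `0`. -/
theorem stmt10 {X : Type*} [MetricSpace X] :
    (∃ C > 0, ∀ r > 0, ∀ (k : ℕ) (p : ℕ → X),
        (∀ i < k, dist (p i) (p (i + 1)) ≤ r) →
        ∀ i ≤ k, ∀ j ≤ k, dist (p i) (p j) ≤ C * r) ↔
    NagataDimLE X 0 := by
  constructor
  · rintro ⟨C, hC, h⟩
    refine ⟨C, hC, fun s hs => ?_⟩
    let R : X → X → Prop := fun x y => dist x y ≤ s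
    have hsymm : ∀ {x y}, Relation.ReflTransGen R x y → Relation.ReflTransGen R y x := by
      intro x y hxy
      induction hxy with
      | refl => exact .refl
      | tail _ hbc ih => exact .head ((dist_comm _ _).trans_le hbc) ih
    refine ⟨range fun x => {y | Relation.ReflTransGen R x y},
      fun x => ⟨_, ⟨x, rfl⟩, .refl⟩, ?_, fun E hE => ?_⟩
    · rintro _ ⟨z, rfl⟩ x hx y hy
      obtain ⟨k, p, rfl, rfl, hp⟩ := ((hsymm hx).trans hy).exists_nat_path
      exact h s hs k p hp 0 k.zero_le k le_rfl
    · simp only [Nat.cast_zero, zero_add]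
      rw [Set.encard_le_one_iff]
      rintro _ _ ⟨⟨x, rfl⟩, u, hu, huE⟩ ⟨⟨y, rfl⟩, v, hv, hvE⟩
      have hxy : Relation.ReflTransGen R x y :=
        (Relation.ReflTransGen.tail hu (hE u huE v hvE)).trans (hsymm hv)
      ext z
      exact ⟨fun hz => (hsymm hxy).trans hz, fun hz => hxy.trans hz⟩
  · rintro ⟨c, hc, h⟩
    refine ⟨c, hc, fun r hr k p hp => ?_⟩
    obtain ⟨𝒰, hcov, hdiam, hmult⟩ := h r hr
    obtain ⟨U, hU, h0⟩ := hcov (p 0)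
    have hmem : ∀ i ≤ k, p i ∈ U := by
      intro i
      induction i with
      | zero => exact fun _ => h0
      | succ i ih =>
        intro hi
        obtain ⟨V, hV, hiV⟩ := hcov (p (i + 1))
        have hd := hp i (by omega)
        have hE := hmult {p i, p (i + 1)} (by
          rintro x (rfl | rfl) y (rfl | rfl)
          · simpa using hr.le
          · exact hd
          · rwa [dist_comm]
          · simpa using hr.le)
        simp only [Nat.cast_zero, zero_add] at hE
        rw [Set.encard_le_one_iff] at hE
        rw [hE U V ⟨hU, p i, ih (by omega), by simp⟩ ⟨hV, p (i + 1), hiV, by simp⟩]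
        exact hiV
    exact fun i hi j hj => hdiam U hU _ (hmem i hi) _ (hmem j hj)
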